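/- For every t with 2 ≤ t ≤ m−1: B^t = {x ∈ F^n : p^t(x) = 0 and Σ_{j=0}^{2^{m−t}−1} Σ_{even i, 0 ≤ i < 2^t} x^t_{i,j} = 0}, and |B^t| = 2^{2^{m−t}(2^t−1)−1}. -/

import Mathlib

open Finset Pointwise

abbrev Word (n : ℕ) := Fin n → ZMod 2

def FEv (n : ℕ) : Set (Word n) := {x | Even (hammingNorm x)}

def FOd (n : ℕ) : Set (Word n) := {x | ¬ Even (hammingNorm x)}

def nbr {n : ℕ} (S : Set (Word n)) : Set (Word n) := {y | ∃ x ∈ S, hammingDist y x = 1}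

def theta {n : ℕ} (G : Set (Word n)) : Set (Word n) :=
  {x | Even (hammingNorm x) ∧ nbr {x} ⊆ nbr G}

def ExtPerfect {n : ℕ} (C : Set (Word n)) : Prop :=
  C ⊆ FEv n ∧ (∀ x ∈ C, ∀ y ∈ C, x ≠ y → Disjoint (nbr {x}) (nbr {y})) ∧ nbr C = FOd n

def IsIsometry {n : ℕ} (g : Word n → Word n) : Prop :=
  Function.Bijective g ∧ ∀ x y, hammingDist (g x) (g y) = hammingDist x y

def embWord (m t : ℕ) (v : Word (2 ^ (m - t))) : Word (2 ^ m) := fun i =>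
  if h : (i : ℕ) < 2 ^ (m - t) then v ⟨i, h⟩
  else if h2 : (i : ℕ) < 2 * 2 ^ (m - t) then v ⟨(i : ℕ) - 2 ^ (m - t), by omega⟩
  else 0

def Vt (m t : ℕ) : Set (Word (2 ^ m)) :=
  {x | ∃ v : Word (2 ^ (m - t)), Even (hammingNorm v) ∧ x = embWord m t v}

def At (m : ℕ) : ℕ → Set (Word (2 ^ m))
  | 0 => {0}
  | 1 => Vt m 1
  | t + 2 => Vt m (t + 2) + At m (t + 1)

def IsComp (m t : ℕ) (G : Set (Word (2 ^ m))) : Prop :=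
  G ⊆ FEv (2 ^ m) ∧ G.ncard = (At m t).ncard ∧ nbr G = nbr (At m t)

def IsMuComp (m t : ℕ) (μ : Word (2 ^ m)) (M : Set (Word (2 ^ m))) : Prop :=
  (∀ i : Fin (2 ^ m), 2 ^ (m - t) ≤ (i : ℕ) → μ i = 0) ∧
  ∃ G, IsComp m t G ∧ M = (fun x => μ + x) '' G

def arrEntry (m t : ℕ) (x : Word (2 ^ m)) (i : Fin (2 ^ t)) (j : Fin (2 ^ (m - t))) : ZMod 2 :=
  x ⟨((i : ℕ) * 2 ^ (m - t) + (j : ℕ)) % 2 ^ m, Nat.mod_lt _ (Nat.two_pow_pos m)⟩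

def pchk (m t : ℕ) (x : Word (2 ^ m)) : Word (2 ^ (m - t)) :=
  fun j => ∑ i : Fin (2 ^ t), arrEntry m t x i j

def Bt (m : ℕ) : ℕ → Set (Word (2 ^ m))
  | 0 => Vt m 1
  | 1 => Vt m 1
  | t + 2 => Vt m (t + 2) + theta (At m (t + 1))

/-- The sum of the coordinates of a word whose index satisfies `p`. -/
def maskSum {n : ℕ} (p : ℕ → Prop) [DecidablePred p] : Word n →ₗ[ZMod 2] ZMod 2 where
  toFun x := ∑ k : Fin n, if p k then x k else 0
  map_add' x y := by
    rw [← Finset.sum_add_distrib]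
    refine Finset.sum_congr rfl fun k _ => ?_
    split_ifs <;> simp
  map_smul' c x := by
    simp [Finset.mul_sum]

/-- The sum of the coordinates whose index is congruent to `j` modulo `2 ^ r`. -/
abbrev residueSum {n : ℕ} (r j : ℕ) : Word n →ₗ[ZMod 2] ZMod 2 :=
  maskSum fun k => k % 2 ^ r = j

/-- The sum of the coordinates whose index has binary digit `0` at position `b`. -/
abbrev zeroBitSum {n : ℕ} (b : ℕ) : Word n →ₗ[ZMod 2] ZMod 2 :=
  maskSum fun k => k / 2 ^ b % 2 = 0

lemma maskSum_apply {n : ℕ} (p : ℕ → Prop) [DecidablePred p] (x : Word n) :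
    maskSum p x = ∑ k : Fin n, if p k then x k else 0 := rfl

lemma maskSum_single {n : ℕ} (p : ℕ → Prop) [DecidablePred p] (k : Fin n) :
    maskSum p (Pi.single k 1 : Word n) = if p k then 1 else 0 := by
  rw [maskSum_apply, Finset.sum_eq_single k]
  · simp
  · intro b _ hb
    simp [hb]
  · simp

lemma residueSum_of_le {n r j : ℕ} (hj : 2 ^ r ≤ j) (x : Word n) : residueSum r j x = 0 := by
  rw [maskSum_apply]
  refine Finset.sum_eq_zero fun k _ => if_neg ?_
  have := Nat.mod_lt (k : ℕ) (Nat.two_pow_pos r)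
  omega

lemma maskSum_eq_sum_residueSum {n r : ℕ} (p : ℕ → Prop) [DecidablePred p]
    (hp : ∀ k, p k ↔ p (k % 2 ^ r)) (x : Word n) :
    maskSum p x = ∑ j ∈ Finset.range (2 ^ r), if p j then residueSum r j x else 0 := by
  simp only [maskSum_apply, ← Finset.sum_filter (p := p), Finset.sum_comm (t := univ)]
  refine Finset.sum_congr rfl fun k _ => ?_
  have hk := Nat.mod_lt (k : ℕ) (Nat.two_pow_pos r)
  rw [Finset.sum_ite_eq]
  simp [hk, ← hp]

lemma maskSum_eq_zero {n r : ℕ} (p : ℕ → Prop) [DecidablePred p]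
    (hp : ∀ k, p k ↔ p (k % 2 ^ r)) {x : Word n} (hx : ∀ j, residueSum r j x = 0) :
    maskSum p x = 0 := by
  rw [maskSum_eq_sum_residueSum p hp]
  exact Finset.sum_eq_zero fun j _ => by rw [hx, ite_self]

lemma residueSum_eq_zero_of_succ {n r : ℕ} {x : Word n} (hx : ∀ j, residueSum (r + 1) j x = 0)
    (j : ℕ) : residueSum r j x = 0 :=
  maskSum_eq_zero _ (fun k => by rw [Nat.mod_mod_of_dvd _ (pow_dvd_pow 2 r.le_succ)]) hx

lemma zeroBitSum_eq_zero_of_succ {n r : ℕ} {x : Word n} (hx : ∀ j, residueSum (r + 1) j x = 0) :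
    zeroBitSum r x = 0 :=
  maskSum_eq_zero _ (fun k => by
    rw [pow_succ, Nat.mod_mul_right_div_self, Nat.mod_mod]) hx

lemma even_hammingNorm_iff {n : ℕ} (x : Word n) : Even (hammingNorm x) ↔ ∑ k, x k = 0 := by
  have h : ((hammingNorm x : ℕ) : ZMod 2) = ∑ k, x k := by
    rw [hammingNorm, Finset.card_filter, Nat.cast_sum]
    refine Finset.sum_congr rfl fun k _ => ?_
    generalize x k = a
    revert a
    decide
  rw [← h, ZMod.natCast_eq_zero_iff_even]

lemma even_hammingNorm_of_residueSum {n r : ℕ} {x : Word n} (hx : ∀ j, residueSum r j x = 0) :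
    Even (hammingNorm x) := by
  rw [even_hammingNorm_iff]
  have h := maskSum_eq_zero (fun _ => True) (fun _ => Iff.rfl) hx
  simpa [maskSum_apply] using h

lemma hammingDist_eq_one_iff {n : ℕ} (y x : Word n) :
    hammingDist y x = 1 ↔ ∃ k, y = x + Pi.single k 1 := by
  rw [hammingDist, Finset.card_eq_one]
  refine exists_congr fun k => ?_
  have key : ∀ a b : ZMod 2, a ≠ b ↔ a = b + 1 := by decide
  constructor
  · intro h
    funext i
    have hi : y i ≠ x i ↔ i = k := by
      simpa using Finset.ext_iff.mp h i
    by_cases hik : i = k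
    · subst hik
      simpa using (key _ _).mp (hi.mpr rfl)
    · simpa [hik] using hi
  · rintro rfl
    ext i
    by_cases hik : i = k
    · subst hik
      simp
    · simp [hik]

/-- A word read as a sequence indexed by `ℕ`, extended by zero. -/
def coord {n : ℕ} (x : Word n) (k : ℕ) : ZMod 2 := if h : k < n then x ⟨k, h⟩ else 0

lemma coord_val {n : ℕ} (x : Word n) (k : Fin n) : coord x k = x k := by
  simp [coord]

lemma maskSum_eq_sum_range {n : ℕ} (p : ℕ → Prop) [DecidablePred p] (x : Word n) :
    maskSum p x = ∑ k ∈ Finset.range n, if p k then coord x k else 0 := by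
  simp [maskSum_apply, Finset.sum_range, coord_val]

lemma maskSum_of_support {n N : ℕ} (p : ℕ → Prop) [DecidablePred p] {w : Word n} (hN : N + N ≤ n)
    (hw : ∀ k, N + N ≤ k → coord w k = 0) :
    maskSum p w = ∑ j ∈ Finset.range N,
      ((if p j then coord w j else 0) + if p (N + j) then coord w (N + j) else 0) := by
  rw [maskSum_eq_sum_range, ← Finset.sum_subset (Finset.range_mono hN), Finset.sum_range_add,
    Finset.sum_add_distrib]
  intro k _ hk
  rw [hw k (by simpa using hk), ite_self]

lemma residueSum_of_support {n r j : ℕ} {w : Word n} (hr : 2 ^ r + 2 ^ r ≤ n)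
    (hw : ∀ k, 2 ^ r + 2 ^ r ≤ k → coord w k = 0) (hj : j < 2 ^ r) :
    residueSum r j w = coord w j + coord w (2 ^ r + j) := by
  rw [maskSum_of_support _ hr hw, Finset.sum_eq_single j]
  · simp [Nat.mod_eq_of_lt hj]
  · intro b hb hbj
    simp [Nat.mod_eq_of_lt (Finset.mem_range.mp hb), hbj]
  · intro h
    exact absurd (Finset.mem_range.mpr hj) h

lemma zeroBitSum_of_support {n r : ℕ} {w : Word n} (hr : 2 ^ r + 2 ^ r ≤ n)
    (hw : ∀ k, 2 ^ r + 2 ^ r ≤ k → coord w k = 0) :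
    zeroBitSum r w = ∑ j ∈ Finset.range (2 ^ r), coord w j := by
  rw [maskSum_of_support _ hr hw]
  refine Finset.sum_congr rfl fun j hj => ?_
  have hj := Finset.mem_range.mp hj
  simp [Nat.div_eq_of_lt hj, Nat.add_div_left _ (Nat.two_pow_pos r)]

lemma mem_Vt_iff {m t : ℕ} (ht : 1 ≤ t) (htm : t ≤ m) (w : Word (2 ^ m)) :
    w ∈ Vt m t ↔ (∀ k, 2 ^ (m - t) + 2 ^ (m - t) ≤ k → coord w k = 0) ∧
      (∀ j, residueSum (m - t) j w = 0) ∧ zeroBitSum (m - t) w = 0 := by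
  have hr : 2 ^ (m - t) + 2 ^ (m - t) ≤ 2 ^ m := by
    rw [← two_mul, ← pow_succ']
    exact Nat.pow_le_pow_right two_pos (by omega)
  have haa : ∀ a : ZMod 2, a + a = 0 := by decide
  constructor
  · rintro ⟨v, hv, rfl⟩
    have hsupp : ∀ k, 2 ^ (m - t) + 2 ^ (m - t) ≤ k → coord (embWord m t v) k = 0 := by
      intro k hk
      unfold coord embWord
      split_ifs with h1 h2 h3
      · exact absurd h2 (by dsimp only; omega)
      · exact absurd h3 (by dsimp only; omega)
      · rfl
      · rfl
    have hlow : ∀ j, (hj : j < 2 ^ (m - t)) → coord (embWord m t v) j = v ⟨j, hj⟩ := by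
      intro j hj
      have : j < 2 ^ m := by omega
      simp [coord, embWord, hj, this]
    have hhigh : ∀ j, (hj : j < 2 ^ (m - t)) →
        coord (embWord m t v) (2 ^ (m - t) + j) = v ⟨j, hj⟩ := by
      intro j hj
      have h1 : 2 ^ (m - t) + j < 2 ^ m := by omega
      have h2 : 2 ^ (m - t) + j < 2 * 2 ^ (m - t) := by omega
      simp [coord, embWord, h1, h2]
    refine ⟨hsupp, fun j => ?_, ?_⟩
    · rcases lt_or_ge j (2 ^ (m - t)) with hj | hj
      · rw [residueSum_of_support hr hsupp hj, hlow j hj, hhigh j hj, haa]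
      · exact residueSum_of_le hj _
    · rw [zeroBitSum_of_support hr hsupp, Finset.sum_range, ← (even_hammingNorm_iff v).mp hv]
      exact Finset.sum_congr rfl fun j _ => hlow j j.2
  · rintro ⟨hsupp, hres, hzero⟩
    refine ⟨fun j => coord w j, ?_, ?_⟩
    · rw [even_hammingNorm_iff, ← Finset.sum_range (fun j => coord w j), ←
        zeroBitSum_of_support hr hsupp, hzero]
    · funext k
      unfold embWord
      split_ifs with h1 h2
      · exact (coord_val w k).symm
      · have h := hres (k - 2 ^ (m - t))
        rw [residueSum_of_support hr hsupp (by omega), Nat.add_sub_cancel' (by omega)] at h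
        have hab : ∀ a b : ZMod 2, a + b = 0 → b = a := by decide
        rw [← coord_val w k]
        exact hab _ _ h
      · rw [← coord_val w k]
        exact hsupp k (by omega)

lemma zeroBitSum_of_mem_Vt {m t b : ℕ} (ht : 1 ≤ t) (htm : t ≤ m) (hb : m - t < b)
    {w : Word (2 ^ m)} (hw : w ∈ Vt m t) : zeroBitSum b w = 0 := by
  obtain ⟨hsupp, hres, -⟩ := (mem_Vt_iff ht htm w).mp hw
  have h := (even_hammingNorm_iff w).mp (even_hammingNorm_of_residueSum hres)
  rw [← h, maskSum_apply]
  refine Finset.sum_congr rfl fun k _ => ?_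
  split_ifs with hk
  · rfl
  · rw [← coord_val w k]
    refine (hsupp k ?_).symm
    by_contra hlt
    apply hk
    rw [Nat.div_eq_of_lt]
    calc (k : ℕ) < 2 ^ (m - t) + 2 ^ (m - t) := by omega
      _ = 2 ^ (m - t + 1) := by ring
      _ ≤ 2 ^ b := Nat.pow_le_pow_right two_pos hb

/-- A word satisfying the two checks of level `r` differs by an element of `V` from a word
whose residue sums of level `r + 1` all vanish. -/
lemma exists_mem_Vt_residueSum_eq {m t : ℕ} (ht : 1 ≤ t) (htm : t ≤ m) {x : Word (2 ^ m)}
    (hres : ∀ j, residueSum (m - t) j x = 0) (hzero : zeroBitSum (m - t) x = 0) :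
    ∃ w ∈ Vt m t, ∀ j, residueSum (m - t + 1) j (x - w) = 0 := by
  set r := m - t with hr
  have hrn : 2 ^ (r + 1) ≤ 2 ^ m := Nat.pow_le_pow_right two_pos (by omega)
  set w : Word (2 ^ m) := fun k => residueSum (r + 1) k x with hw
  have hdiff : ∀ j, residueSum (r + 1) j (x - w) = 0 := by
    intro j
    rcases lt_or_ge j (2 ^ (r + 1)) with hj | hj
    · rw [map_sub, sub_eq_zero, eq_comm, maskSum_apply,
        Finset.sum_eq_single (⟨j, hj.trans_le hrn⟩ : Fin (2 ^ m))]
      · simp [Nat.mod_eq_of_lt hj, hw]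
      · intro k _ hk
        rcases lt_or_ge (k : ℕ) (2 ^ (r + 1)) with hk' | hk'
        · rw [if_neg]
          rw [Nat.mod_eq_of_lt hk']
          exact fun h => hk (Fin.ext h)
        · rw [hw]
          simp only [residueSum_of_le hk', ite_self]
      · simp
    · exact residueSum_of_le hj _
  refine ⟨w, ?_, hdiff⟩
  rw [mem_Vt_iff ht htm]
  refine ⟨fun k hk => ?_, fun j => ?_, ?_⟩
  · unfold coord
    split_ifs with hkm
    · exact residueSum_of_le (by rw [pow_succ]; rw [← hr] at hk; dsimp only; omega) x
    · rfl
  · have h := residueSum_eq_zero_of_succ hdiff j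
    rwa [map_sub, hres, zero_sub, neg_eq_zero] at h
  · have h := zeroBitSum_eq_zero_of_succ hdiff
    rwa [map_sub, hzero, zero_sub, neg_eq_zero] at h

lemma At_succ (m t : ℕ) : At m (t + 1) = Vt m (t + 1) + At m t := by
  cases t with
  | zero => simp [At]
  | succ t => rfl

lemma mem_At_iff {m t : ℕ} (htm : t ≤ m) (x : Word (2 ^ m)) :
    x ∈ At m t ↔ (∀ j, residueSum (m - t) j x = 0) ∧
      ∀ b, m - t ≤ b → b < m → zeroBitSum b x = 0 := by
  induction t generalizing x with
  | zero =>
    simp only [At, Set.mem_singleton_iff, Nat.sub_zero]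
    constructor
    · rintro rfl
      simp
    · rintro ⟨h, -⟩
      funext k
      have hk := h k
      rw [maskSum_apply, Finset.sum_eq_single k] at hk
      · simpa [Nat.mod_eq_of_lt k.2] using hk
      · intro i _ hi
        rw [if_neg]
        rw [Nat.mod_eq_of_lt i.2]
        exact fun h => hi (Fin.ext h)
      · simp
  | succ t ih =>
    have hr : m - t = m - (t + 1) + 1 := by omega
    rw [At_succ, Set.mem_add]
    constructor
    · rintro ⟨w, hw, a, ha, rfl⟩
      obtain ⟨hares, hazero⟩ := (ih (by omega) a).mp ha
      obtain ⟨-, hwres, hwzero⟩ := (mem_Vt_iff (by omega) htm w).mp hw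
      rw [hr] at hares
      refine ⟨fun j => ?_, fun b hb hbm => ?_⟩
      · rw [map_add, hwres, residueSum_eq_zero_of_succ hares, add_zero]
      · rcases hb.eq_or_lt with rfl | hb
        · rw [map_add, hwzero, zeroBitSum_eq_zero_of_succ hares, add_zero]
        · rw [map_add, zeroBitSum_of_mem_Vt (by omega) htm hb hw,
            hazero b (by omega) hbm, add_zero]
    · rintro ⟨hres, hzero⟩
      obtain ⟨w, hw, hdiff⟩ := exists_mem_Vt_residueSum_eq (by omega) htm hres
        (hzero _ le_rfl (by omega))
      refine ⟨w, hw, x - w, (ih (by omega) _).mpr ⟨hr ▸ hdiff, fun b hb hbm => ?_⟩,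
        add_sub_cancel _ _⟩
      rw [map_sub, hzero b (by omega) hbm, zeroBitSum_of_mem_Vt (by omega) htm (by omega) hw,
        sub_zero]

lemma exists_index {m r j : ℕ} (hrm : r ≤ m) (hj : j < 2 ^ r) (c : ℕ → Prop) [DecidablePred c] :
    ∃ k : Fin (2 ^ m), (k : ℕ) % 2 ^ r = j ∧
      ∀ b, r ≤ b → b < m → ((k : ℕ) / 2 ^ b % 2 = 0 ↔ c b) := by
  let f : Fin m → Bool := fun b => if (b : ℕ) < r then j.testBit b else ! decide (c b)
  refine ⟨⟨Nat.ofBits f, Nat.ofBits_lt_two_pow f⟩, ?_, fun b hb hbm => ?_⟩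
  · apply Nat.eq_of_testBit_eq
    intro i
    rw [Nat.testBit_mod_two_pow]
    by_cases hi : i < r
    · rw [Nat.testBit_ofBits_lt f i (by omega)]
      simp [f, hi]
    · rw [Nat.testBit_lt_two_pow (hj.trans_le (Nat.pow_le_pow_right two_pos (by omega)))]
      simp [hi]
  · have h := Nat.testBit_ofBits_lt f b hbm
    rw [Nat.testBit_eq_decide_div_mod_eq] at h
    have hb' : ¬ b < r := by omega
    by_cases hc : c b <;> simp [f, hb', hc] at h ⊢ <;> omega

lemma mem_nbr_At_iff {m t : ℕ} (htm : t ≤ m) (y : Word (2 ^ m)) :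
    y ∈ nbr (At m t) ↔
      ∃ j < 2 ^ (m - t), ∀ i, residueSum (m - t) i y = if j = i then 1 else 0 := by
  simp only [nbr, Set.mem_ofPred_eq, hammingDist_eq_one_iff]
  constructor
  · rintro ⟨x, hx, k, rfl⟩
    refine ⟨k % 2 ^ (m - t), Nat.mod_lt _ (Nat.two_pow_pos _), fun i => ?_⟩
    rw [map_add, ((mem_At_iff htm x).mp hx).1, maskSum_single, zero_add]
  · rintro ⟨j, hj, hy⟩
    obtain ⟨k, hkj, hk⟩ := exists_index (m := m) (by omega) hj fun b => zeroBitSum b y = 1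
    have haa : ∀ a : ZMod 2, a - (if a = 1 then 1 else 0) = 0 := by decide
    refine ⟨y - Pi.single k 1, (mem_At_iff htm _).mpr ⟨fun i => ?_, fun b hb hbm => ?_⟩, k,
      (sub_add_cancel _ _).symm⟩
    · rw [map_sub, hy, maskSum_single, hkj, sub_self]
    · rw [map_sub, maskSum_single]
      simp only [hk b hb hbm]
      exact haa _

lemma mem_theta_At_iff {m t : ℕ} (htm : t + 2 ≤ m) (x : Word (2 ^ m)) :
    x ∈ theta (At m t) ↔ ∀ j, residueSum (m - t) j x = 0 := by
  set r := m - t with hr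
  have h4 : 4 ≤ 2 ^ r := Nat.pow_le_pow_right (n := 2) two_pos (show 2 ≤ r by omega)
  have hrm : 2 ^ r ≤ 2 ^ m := Nat.pow_le_pow_right two_pos (by omega)
  simp only [theta, Set.mem_ofPred_eq]
  constructor
  · rintro ⟨-, hsub⟩ i
    by_contra hi
    have hne : ∀ a : ZMod 2, a ≠ 0 → a = 1 := by decide
    have hi1 := hne _ hi
    have key : ∀ k < 2 ^ r, k ≠ i →
        residueSum r k x = 1 ∧ ∀ l, l ≠ k → l ≠ i → residueSum r l x = 0 := by
      intro k hk hki
      have hmem : x + Pi.single ⟨k, hk.trans_le hrm⟩ 1 ∈ nbr (At m t) :=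
        hsub ⟨x, rfl, (hammingDist_eq_one_iff _ _).mpr ⟨_, rfl⟩⟩
      obtain ⟨j, -, hj⟩ := (mem_nbr_At_iff (by omega) _).mp hmem
      simp only [map_add, maskSum_single, ← hr, Nat.mod_eq_of_lt hk] at hj
      have hji : j = i := by
        by_contra hji
        have := hj i
        simp [hi1, hki, hji] at this
      subst hji
      refine ⟨?_, fun l hlk hlj => ?_⟩
      · have := hj k
        rw [if_pos rfl, if_neg hki.symm] at this
        exact hne _ fun h0 => by simp [h0] at this
      · have := hj l
        rwa [if_neg hlk.symm, if_neg hlj.symm, add_zero] at this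
    obtain ⟨k, l, hk, hl, hki, hli, hlk⟩ :
        ∃ k l, k < 2 ^ r ∧ l < 2 ^ r ∧ k ≠ i ∧ l ≠ i ∧ l ≠ k := by
      by_cases h0 : i = 0
      · exact ⟨1, 2, by omega, by omega, by omega, by omega, by omega⟩
      · by_cases h1 : i = 1
        · exact ⟨0, 2, by omega, by omega, by omega, by omega, by omega⟩
        · exact ⟨0, 1, by omega, by omega, by omega, by omega, by omega⟩
    have h1 := (key l hl hli).1
    rw [(key k hk hki).2 l hlk hli] at h1
    exact zero_ne_one h1
  · intro hx
    refine ⟨even_hammingNorm_of_residueSum hx, ?_⟩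
    rintro y ⟨z, rfl, hy⟩
    obtain ⟨k, rfl⟩ := (hammingDist_eq_one_iff _ _).mp hy
    refine (mem_nbr_At_iff (by omega) _).mpr
      ⟨k % 2 ^ r, Nat.mod_lt _ (Nat.two_pow_pos _), fun i => ?_⟩
    rw [map_add, hx, maskSum_single, zero_add]

lemma mem_Bt_iff {m t : ℕ} (ht : 2 ≤ t) (htm : t + 1 ≤ m) (x : Word (2 ^ m)) :
    x ∈ Bt m t ↔ (∀ j, residueSum (m - t) j x = 0) ∧ zeroBitSum (m - t) x = 0 := by
  obtain ⟨s, rfl⟩ : ∃ s, t = s + 2 := ⟨t - 2, by omega⟩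
  have hr : m - (s + 1) = m - (s + 2) + 1 := by omega
  simp only [Bt, Set.mem_add, mem_theta_At_iff (show s + 1 + 2 ≤ m by omega), hr]
  constructor
  · rintro ⟨w, hw, a, ha, rfl⟩
    obtain ⟨-, hwres, hwzero⟩ := (mem_Vt_iff (by omega) (by omega) w).mp hw
    refine ⟨fun j => ?_, ?_⟩
    · rw [map_add, hwres, residueSum_eq_zero_of_succ ha, add_zero]
    · rw [map_add, hwzero, zeroBitSum_eq_zero_of_succ ha, add_zero]
  · rintro ⟨hres, hzero⟩
    obtain ⟨w, hw, hdiff⟩ := exists_mem_Vt_residueSum_eq (by omega) (by omega) hres hzero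
    exact ⟨w, hw, x - w, hdiff, add_sub_cancel _ _⟩

lemma sum_range_mul_eq (a N : ℕ) (f : ℕ → ZMod 2) :
    ∑ k ∈ Finset.range (a * N), f k =
      ∑ i ∈ Finset.range a, ∑ j ∈ Finset.range N, f (i * N + j) := by
  induction a with
  | zero => simp
  | succ a ih => rw [Nat.succ_mul, Finset.sum_range_add, ih, Finset.sum_range_succ]

lemma maskSum_eq_sum_arrEntry {m t : ℕ} (htm : t ≤ m) (p : ℕ → Prop) [DecidablePred p]
    (x : Word (2 ^ m)) :
    maskSum p x = ∑ i : Fin (2 ^ t), ∑ j : Fin (2 ^ (m - t)),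
      if p (i * 2 ^ (m - t) + j) then arrEntry m t x i j else 0 := by
  have hm : 2 ^ m = 2 ^ t * 2 ^ (m - t) := by rw [← pow_add, Nat.add_sub_cancel' htm]
  rw [maskSum_eq_sum_range,
    (congrArg (fun N => ∑ k ∈ Finset.range N, if p k then coord x k else 0) hm :),
    sum_range_mul_eq]
  simp only [Finset.sum_range]
  refine Finset.sum_congr rfl fun i _ => Finset.sum_congr rfl fun j _ => ?_
  have hlt : (i : ℕ) * 2 ^ (m - t) + j < 2 ^ m := by
    calc (i : ℕ) * 2 ^ (m - t) + j < i * 2 ^ (m - t) + 2 ^ (m - t) := by omega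
      _ = (i + 1) * 2 ^ (m - t) := by ring
      _ ≤ 2 ^ t * 2 ^ (m - t) := Nat.mul_le_mul_right _ i.2
      _ = 2 ^ m := hm.symm
  simp [arrEntry, coord, hlt, Nat.mod_eq_of_lt hlt]

lemma residueSum_eq_pchk {m t : ℕ} (htm : t ≤ m) (x : Word (2 ^ m)) (j : Fin (2 ^ (m - t))) :
    residueSum (m - t) j x = pchk m t x j := by
  rw [maskSum_eq_sum_arrEntry htm, pchk]
  refine Finset.sum_congr rfl fun i _ => ?_
  simp [Nat.mod_eq_of_lt, Fin.val_inj]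

lemma zeroBitSum_eq_sum_arrEntry {m t : ℕ} (htm : t ≤ m) (x : Word (2 ^ m)) :
    zeroBitSum (m - t) x = ∑ j : Fin (2 ^ (m - t)), ∑ i : Fin (2 ^ t),
      if (i : ℕ) % 2 = 0 then arrEntry m t x i j else 0 := by
  rw [maskSum_eq_sum_arrEntry htm, Finset.sum_comm]
  refine Finset.sum_congr rfl fun j _ => Finset.sum_congr rfl fun i _ => ?_
  rw [mul_comm, Nat.mul_add_div (Nat.two_pow_pos _), Nat.div_eq_of_lt j.2, add_zero]

/-- The residue sums modulo `2 ^ r` together with the zero-bit sum at position `r`. -/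
def checkMap (n r : ℕ) : Word n →ₗ[ZMod 2] (Fin (2 ^ r) → ZMod 2) × ZMod 2 :=
  (LinearMap.pi fun j : Fin (2 ^ r) => residueSum r (j : ℕ)).prod (zeroBitSum r)

lemma mem_ker_checkMap {n r : ℕ} (x : Word n) :
    x ∈ (checkMap n r).ker ↔ (∀ j, residueSum r j x = 0) ∧ zeroBitSum r x = 0 := by
  rw [LinearMap.mem_ker, checkMap, LinearMap.prod_apply, Prod.ext_iff]
  refine and_congr ⟨fun h j => ?_, fun h => funext fun j => h j⟩ Iff.rfl
  rcases lt_or_ge j (2 ^ r) with hj | hj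
  · exact congrFun h ⟨j, hj⟩
  · exact residueSum_of_le hj x

lemma checkMap_surjective {m r : ℕ} (hrm : r + 1 ≤ m) :
    Function.Surjective (checkMap (2 ^ m) r) := by
  have hlt : 2 ^ r + 2 ^ r ≤ 2 ^ m := by
    rw [← two_mul, ← pow_succ']
    exact Nat.pow_le_pow_right two_pos hrm
  have hpos := Nat.two_pow_pos r
  rintro ⟨c, d⟩
  set y : Word (2 ^ m) := fun k => if h : (k : ℕ) < 2 ^ r then c ⟨k, h⟩ else 0 with hy
  set u : Word (2 ^ m) :=
    Pi.single ⟨0, by omega⟩ 1 + Pi.single ⟨2 ^ r, by omega⟩ 1 with hu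
  have hyres : ∀ j : Fin (2 ^ r), residueSum r j y = c j := by
    intro j
    rw [maskSum_apply, Finset.sum_eq_single (⟨j, by omega⟩ : Fin (2 ^ m))]
    · simp [hy, Nat.mod_eq_of_lt j.2]
    · intro k _ hk
      by_cases hk' : (k : ℕ) < 2 ^ r
      · rw [if_neg]
        rw [Nat.mod_eq_of_lt hk']
        exact fun h => hk (Fin.ext h)
      · simp [hy, hk']
    · simp
  have hures : ∀ j, residueSum r j u = 0 := by
    have haa : ∀ a : ZMod 2, a + a = 0 := by decide
    intro j
    rw [hu, map_add, maskSum_single, maskSum_single]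
    simp only [Nat.zero_mod, Nat.mod_self]
    exact haa _
  have huzero : zeroBitSum r u = 1 := by
    rw [hu, map_add, maskSum_single, maskSum_single]
    simp [Nat.div_self hpos]
  refine ⟨y + (d - zeroBitSum r y) • u, Prod.ext (funext fun j => ?_) ?_⟩
  · change residueSum r j (y + (d - zeroBitSum r y) • u) = c j
    rw [map_add, map_smul, hures, hyres, smul_zero, add_zero]
  · change zeroBitSum r (y + (d - zeroBitSum r y) • u) = d
    rw [map_add, map_smul, huzero, smul_eq_mul, mul_one, add_sub_cancel]

lemma ncard_ker_checkMap {m r : ℕ} (hrm : r + 1 ≤ m) :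
    ((checkMap (2 ^ m) r).ker : Set (Word (2 ^ m))).ncard = 2 ^ (2 ^ m - 2 ^ r - 1) := by
  have h := (checkMap (2 ^ m) r).finrank_range_add_finrank_ker
  rw [LinearMap.range_eq_top.mpr (checkMap_surjective hrm), finrank_top, Module.finrank_prod,
    Module.finrank_fin_fun, Module.finrank_fin_fun, Module.finrank_self] at h
  change Nat.card (checkMap (2 ^ m) r).ker = _
  rw [Module.natCard_eq_pow_finrank (K := ZMod 2), Nat.card_zmod]
  congr 1
  omega

/-- for 2 ≤ t ≤ m-1, B^t = {x : p^t(x) = 0 and Σ_j Σ_{even i} x^t_{i,j} = 0}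
and |B^t| = 2^{2^{m-t}(2^t-1)-1}. -/
theorem stmt_9 (m t : ℕ) (hm : 4 ≤ m) (ht : 2 ≤ t) (ht' : t ≤ m - 1) :
    Bt m t = {x : Word (2 ^ m) | pchk m t x = 0 ∧
      (∑ j : Fin (2 ^ (m - t)), ∑ i : Fin (2 ^ t),
        (if (i : ℕ) % 2 = 0 then arrEntry m t x i j else 0)) = 0} ∧
    (Bt m t).ncard = 2 ^ (2 ^ (m - t) * (2 ^ t - 1) - 1) := by
  have htm : t + 1 ≤ m := by omega
  constructor
  · ext x
    rw [mem_Bt_iff ht htm, Set.mem_ofPred_eq, zeroBitSum_eq_sum_arrEntry (by omega)]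
    refine and_congr_left fun _ => ⟨fun h => funext fun j => ?_, fun h j => ?_⟩
    · rw [← residueSum_eq_pchk (by omega), h, Pi.zero_apply]
    · rcases lt_or_ge j (2 ^ (m - t)) with hj | hj
      · exact (residueSum_eq_pchk (by omega) x ⟨j, hj⟩).trans (congrFun h _)
      · exact residueSum_of_le hj x
  · have hker : Bt m t = (checkMap (2 ^ m) (m - t)).ker := by
      ext x
      rw [mem_Bt_iff ht htm, SetLike.mem_coe, mem_ker_checkMap]
    have hpow : 2 ^ m = 2 ^ (m - t) * 2 ^ t := by rw [← pow_add, Nat.sub_add_cancel (by omega)]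
    rw [hker, ncard_ker_checkMap (by omega), hpow, Nat.mul_sub_one]
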